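/- arXiv:2106.12161 — 9 statements merged into one kernel-verified Lean document; each statement's English description precedes it below -/
import Mathlib

section
/- Let F ∈ ℝ^{m×n}, G ∈ ℝ^{p×q}, and H ∈ ℝ^{r×s} be real matrices. Then the semi-tensor product is associative: (F ⋉ G) ⋉ H = F ⋉ (G ⋉ H). -/
open Matrix

/-- The semi-tensor product (STP) of real matrices:
`M ⋉ N := (M ⊗ I_{t/n}) * (N ⊗ I_{t/p})` where `t = lcm n p`. -/
noncomputable def stp {m n p q : ℕ} (M : Matrix (Fin m) (Fin n) ℝ) (N : Matrix (Fin p) (Fin q) ℝ) :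
    Matrix (Fin (m * (Nat.lcm n p / n))) (Fin (q * (Nat.lcm n p / p))) ℝ :=
  (Matrix.reindex finProdFinEquiv
      (finProdFinEquiv.trans (finCongr (Nat.mul_div_cancel' (Nat.dvd_lcm_left n p))))
      (Matrix.kroneckerMap (· * ·) M
        (1 : Matrix (Fin (Nat.lcm n p / n)) (Fin (Nat.lcm n p / n)) ℝ))) *
  (Matrix.reindex
      (finProdFinEquiv.trans (finCongr (Nat.mul_div_cancel' (Nat.dvd_lcm_right n p))))
      finProdFinEquiv
      (Matrix.kroneckerMap (· * ·) N
        (1 : Matrix (Fin (Nat.lcm n p / p)) (Fin (Nat.lcm n p / p)) ℝ)))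

/-- `A ⊗ I_k`, with free dimensions. -/
noncomputable def kronId {m n : ℕ} (k : ℕ) {M N : ℕ} (hM : M = m * k) (hN : N = n * k)
    (A : Matrix (Fin m) (Fin n) ℝ) : Matrix (Fin M) (Fin N) ℝ :=
  (Matrix.kroneckerMap (· * ·) A (1 : Matrix (Fin k) (Fin k) ℝ)).submatrix
    ((finCongr hM).trans finProdFinEquiv.symm) ((finCongr hN).trans finProdFinEquiv.symm)

lemma kronId_mul {m n l : ℕ} (k : ℕ) {M N L : ℕ} (hM : M = m * k) (hN : N = n * k) (hL : L = l * k)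
    (A : Matrix (Fin m) (Fin n) ℝ) (B : Matrix (Fin n) (Fin l) ℝ) :
    kronId k hM hL (A * B) = kronId k hM hN A * kronId k hN hL B := by
  unfold kronId
  rw [Matrix.submatrix_mul_equiv]
  congr 1
  have := Matrix.mul_kronecker_mul A B (1 : Matrix (Fin k) (Fin k) ℝ) (1 : Matrix (Fin k) (Fin k) ℝ)
  rw [one_mul] at this
  exact this

lemma kronId_kronId {m n : ℕ} (k l : ℕ) {M N M' N' : ℕ} (hM : M = m * k) (hN : N = n * k)
    (hM' : M' = M * l) (hN' : N' = N * l) (kl : ℕ) (hkl : kl = k * l)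
    (h1 : M' = m * kl) (h2 : N' = n * kl) (A : Matrix (Fin m) (Fin n) ℝ) :
    kronId l hM' hN' (kronId k hM hN A) = kronId kl h1 h2 A := by
  subst hkl hM hN
  ext i j
  simp only [kronId, Matrix.submatrix_apply, Matrix.kroneckerMap_apply, Matrix.one_apply,
    Equiv.trans_apply, finCongr_apply, finProdFinEquiv_symm_apply, Fin.ext_iff, mul_assoc]
  congr 1
  · congr 1 <;> simp [Fin.divNat, Nat.div_div_eq_div_mul, mul_comm]
  · have hk : 0 < l := by
      rcases Nat.eq_zero_or_pos l with h | h
      · subst h; have := i.2; simp [hM'] at this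
      · exact h
    have key : ((i : ℕ) % (k * l) = j % (k * l)) ↔
        ((i : ℕ) / l % k = j / l % k ∧ (i : ℕ) % l = j % l) := by
      rw [mul_comm k l, Nat.mod_mul, Nat.mod_mul]
      constructor
      · intro h
        have h3 := congrArg (· % l) h
        simp at h3
        rw [h3] at h
        exact ⟨Nat.eq_of_mul_eq_mul_left hk (Nat.add_left_cancel h), h3⟩
      · rintro ⟨h, h'⟩
        rw [h, h']
    change (if (i : ℕ) / l % k = j / l % k then (1 : ℝ) else 0) *
      (if (i : ℕ) % l = j % l then (1 : ℝ) else 0) =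
      if (i : ℕ) % (k * l) = j % (k * l) then (1 : ℝ) else 0
    simp only [key, ite_and]
    split_ifs <;> simp

lemma stp_eq {m n p q : ℕ} (M : Matrix (Fin m) (Fin n) ℝ) (N : Matrix (Fin p) (Fin q) ℝ) :
    stp M N = kronId (Nat.lcm n p / n) rfl (Nat.mul_div_cancel' (Nat.dvd_lcm_left n p)).symm M *
      kronId (Nat.lcm n p / p) (Nat.mul_div_cancel' (Nat.dvd_lcm_right n p)).symm rfl N := rfl

lemma heq_triple {m n p q r s : ℕ}
    (F : Matrix (Fin m) (Fin n) ℝ) (G : Matrix (Fin p) (Fin q) ℝ)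
    (H : Matrix (Fin r) (Fin s) ℝ) {k1 k2 k3 l1 l2 l3 A B C D A' B' C' D' : ℕ}
    (e1 : k1 = l1) (e2 : k2 = l2) (e3 : k3 = l3)
    (a1 : A = m * k1) (b1 : B = n * k1) (b2 : B = p * k2) (c2 : C = q * k2) (c3 : C = r * k3)
    (d3 : D = s * k3)
    (a1' : A' = m * l1) (b1' : B' = n * l1) (b2' : B' = p * l2) (c2' : C' = q * l2)
    (c3' : C' = r * l3) (d3' : D' = s * l3) :
    HEq (kronId k1 a1 b1 F * kronId k2 b2 c2 G * kronId k3 c3 d3 H)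
      (kronId l1 a1' b1' F * kronId l2 b2' c2' G * kronId l3 c3' d3' H) := by
  subst e1 e2 e3
  obtain rfl := a1.trans a1'.symm
  obtain rfl := b1.trans b1'.symm
  obtain rfl := c2.trans c2'.symm
  obtain rfl := d3.trans d3'.symm
  rfl

lemma heq_empty {a b c d : ℕ} (ha : a = 0) (hb : b = 0) (hc : c = 0) (hd : d = 0)
    (A : Matrix (Fin a) (Fin b) ℝ) (B : Matrix (Fin c) (Fin d) ℝ) : HEq A B := by
  subst ha hb hc hd
  exact heq_of_eq (Subsingleton.elim _ _)

lemma stp_core {m n p q r s a b c d α x y γ X Y T U : ℕ}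
    (F : Matrix (Fin m) (Fin n) ℝ) (G : Matrix (Fin p) (Fin q) ℝ)
    (H : Matrix (Fin r) (Fin s) ℝ) (hn : 0 < n) (hp : 0 < p) (hq : 0 < q) (hr : 0 < r)
    (ha : n * a = T) (hb : p * b = T) (hc : q * c = U) (hd : r * d = U)
    (hα : q * b * α = X) (hα' : r * x = X) (hγ : n * y = Y) (hγ' : p * c * γ = Y)
    (hxy : p * X = q * Y) :
    HEq (kronId α rfl hα.symm (kronId a rfl ha.symm F * kronId b hb.symm rfl G) *
        kronId x hα'.symm rfl H)
      (kronId y rfl hγ.symm F *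
        kronId γ hγ'.symm rfl (kronId c rfl hc.symm G * kronId d hd.symm rfl H)) := by
  have e2 : b * α = c * γ := by
    apply Nat.eq_of_mul_eq_mul_left (Nat.mul_pos hp hq)
    linear_combination p * hα + hxy - q * hγ'
  have e1 : a * α = y := by
    apply Nat.eq_of_mul_eq_mul_left hn
    linear_combination α * ha - α * hb + p * e2 + hγ' - hγ
  have e3 : x = d * γ := by
    apply Nat.eq_of_mul_eq_mul_left hr
    linear_combination hα' - hα + q * e2 + γ * hc - γ * hd
  rw [kronId_mul α rfl (rfl : T * α = T * α) hα.symm,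
    kronId_mul γ hγ'.symm (rfl : U * γ = U * γ) rfl,
    kronId_kronId a α _ _ _ _ (a * α) rfl (by ring) (by rw [← ha]; ring),
    kronId_kronId b α _ _ _ _ (b * α) rfl (by rw [← hb]; ring) (by rw [← hα]; ring),
    kronId_kronId c γ _ _ _ _ (c * γ) rfl (by rw [← hγ']; ring) (by rw [← hc]; ring),
    kronId_kronId d γ _ _ _ _ (d * γ) rfl (by rw [← hd]; ring) (by ring),
    ← Matrix.mul_assoc]
  exact heq_triple F G H e1 e2 e3 _ _ _ _ _ _ _ _ _ _ _ _

/-- Associativity of the semi-tensor product: `(F ⋉ G) ⋉ H = F ⋉ (G ⋉ H)`. -/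
theorem stp_assoc {m n p q r s : ℕ}
    (F : Matrix (Fin m) (Fin n) ℝ) (G : Matrix (Fin p) (Fin q) ℝ)
    (H : Matrix (Fin r) (Fin s) ℝ) :
    HEq (stp (stp F G) H) (stp F (stp G H)) := by
  rcases Nat.eq_zero_or_pos n with hn | hn
  · subst hn; apply heq_empty <;> simp
  rcases Nat.eq_zero_or_pos p with hp | hp
  · subst hp; apply heq_empty <;> simp
  rcases Nat.eq_zero_or_pos q with hq | hq
  · subst hq; apply heq_empty <;> simp
  rcases Nat.eq_zero_or_pos r with hr | hr
  · subst hr; apply heq_empty <;> simp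
  rw [stp_eq (stp F G) H, stp_eq F (stp G H), stp_eq F G, stp_eq G H]
  have hb := Nat.mul_div_cancel' (Nat.dvd_lcm_right n p)
  have hc := Nat.mul_div_cancel' (Nat.dvd_lcm_left q r)
  refine stp_core F G H hn hp hq hr (Nat.mul_div_cancel' (Nat.dvd_lcm_left _ _)) hb hc
    (Nat.mul_div_cancel' (Nat.dvd_lcm_right _ _)) (Nat.mul_div_cancel' (Nat.dvd_lcm_left _ _))
    (Nat.mul_div_cancel' (Nat.dvd_lcm_right _ _)) (Nat.mul_div_cancel' (Nat.dvd_lcm_left _ _))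
    (Nat.mul_div_cancel' (Nat.dvd_lcm_right _ _)) ?_
  generalize Nat.lcm n p / p = b at *
  generalize Nat.lcm q r / q = c at *
  rw [← Nat.lcm_mul_left, ← Nat.lcm_mul_left,
      show p * (q * b) = q * (p * b) by ring, show q * (p * c) = p * (q * c) by ring, hb, hc,
      ← Nat.lcm_mul_left, ← Nat.lcm_mul_left, Nat.lcm_assoc, mul_comm q p]
end

section
/- Let A ∈ ℝ^{n×n} and B ∈ ℝ^{p×p} be invertible square matrices. Then their semi-tensor product A ⋉ B ∈ ℝ^{t×t} (where t = lcm(n, p)) is invertible and (A ⋉ B)^{-1} = B^{-1} ⋉ A^{-1}. -/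
open Matrix

/-- `M ⊗ I_k` viewed as a `t × t` matrix, `t = n * k`. -/
noncomputable def stpExt {n : ℕ} (k t : ℕ) (h : n * k = t) (M : Matrix (Fin n) (Fin n) ℝ) :
    Matrix (Fin t) (Fin t) ℝ :=
  Matrix.reindex (finProdFinEquiv.trans (finCongr h)) (finProdFinEquiv.trans (finCongr h))
    (Matrix.kroneckerMap (· * ·) M (1 : Matrix (Fin k) (Fin k) ℝ))

theorem stpExt_mul {n : ℕ} (k t : ℕ) (h : n * k = t) (M N : Matrix (Fin n) (Fin n) ℝ) :
    stpExt k t h M * stpExt k t h N = stpExt k t h (M * N) := by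
  have := Matrix.mul_kronecker_mul M N (1 : Matrix (Fin k) (Fin k) ℝ)
    (1 : Matrix (Fin k) (Fin k) ℝ)
  rw [Matrix.one_mul] at this
  unfold stpExt
  simp only [Matrix.reindex_apply, Matrix.submatrix_mul_equiv]
  exact congrArg (fun X => Matrix.submatrix X _ _) this.symm

theorem stpExt_one {n : ℕ} (k t : ℕ) (h : n * k = t) :
    stpExt k t h (1 : Matrix (Fin n) (Fin n) ℝ) = 1 := by
  have := Matrix.one_kronecker_one (α := ℝ) (m := Fin n) (n := Fin k)
  unfold stpExt
  rw [Matrix.reindex_apply]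
  refine (congrArg (fun X => Matrix.submatrix X _ _) this).trans ?_
  exact Matrix.submatrix_one_equiv _

theorem stp_reindex {n p : ℕ} (t : ℕ) (A : Matrix (Fin n) (Fin n) ℝ)
    (B : Matrix (Fin p) (Fin p) ℝ) (ht : Nat.lcm n p = t)
    (h1 : n * (Nat.lcm n p / n) = t) (h2 : p * (Nat.lcm n p / p) = t)
    (h1' : n * (t / n) = t) (h2' : p * (t / p) = t) :
    Matrix.reindex (finCongr h1) (finCongr h2) (stp A B) =
      stpExt (t / n) t h1' A * stpExt (t / p) t h2' B := by
  subst ht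
  unfold stp stpExt
  ext i j
  simp only [Matrix.reindex_apply, Matrix.submatrix_apply, Matrix.mul_apply]
  rfl

/-- If `A ∈ ℝ^{n×n}` and `B ∈ ℝ^{p×p}` are invertible, then so is `A ⋉ B ∈ ℝ^{t×t}`
(`t = lcm n p`), and `(A ⋉ B)⁻¹ = B⁻¹ ⋉ A⁻¹`. -/
theorem stp_inv {n p : ℕ}
    (A : Matrix (Fin n) (Fin n) ℝ) (B : Matrix (Fin p) (Fin p) ℝ)
    (hA : IsUnit A) (hB : IsUnit B) :
    IsUnit (Matrix.reindex (finCongr (Nat.mul_div_cancel' (Nat.dvd_lcm_left n p)))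
        (finCongr (Nat.mul_div_cancel' (Nat.dvd_lcm_right n p))) (stp A B)) ∧
    (Matrix.reindex (finCongr (Nat.mul_div_cancel' (Nat.dvd_lcm_left n p)))
        (finCongr (Nat.mul_div_cancel' (Nat.dvd_lcm_right n p))) (stp A B))⁻¹ =
      Matrix.reindex
        (finCongr (show p * (Nat.lcm p n / p) = Nat.lcm n p by
          rw [Nat.mul_div_cancel' (Nat.dvd_lcm_left p n), Nat.lcm_comm]))
        (finCongr (show n * (Nat.lcm p n / n) = Nat.lcm n p by
          rw [Nat.mul_div_cancel' (Nat.dvd_lcm_right p n), Nat.lcm_comm]))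
        (stp B⁻¹ A⁻¹) := by
  have h1 := Nat.mul_div_cancel' (Nat.dvd_lcm_left n p)
  have h2 := Nat.mul_div_cancel' (Nat.dvd_lcm_right n p)
  have hA' := Matrix.mul_nonsing_inv A ((Matrix.isUnit_iff_isUnit_det A).1 hA)
  have hB' := Matrix.mul_nonsing_inv B ((Matrix.isUnit_iff_isUnit_det B).1 hB)
  rw [stp_reindex (Nat.lcm n p) A B rfl _ _ h1 h2,
    stp_reindex (Nat.lcm n p) B⁻¹ A⁻¹ (Nat.lcm_comm p n) _ _ h2 h1]
  have key : (stpExt (n.lcm p / n) (n.lcm p) h1 A * stpExt (n.lcm p / p) (n.lcm p) h2 B) *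
      (stpExt (n.lcm p / p) (n.lcm p) h2 B⁻¹ * stpExt (n.lcm p / n) (n.lcm p) h1 A⁻¹) = 1 := by
    rw [Matrix.mul_assoc, ← Matrix.mul_assoc (stpExt _ _ h2 B), stpExt_mul, hB', stpExt_one,
      Matrix.one_mul, stpExt_mul, hA', stpExt_one]
  exact ⟨IsUnit.of_mul_eq_one _ key, Matrix.inv_eq_right_inv key⟩
end

section
/- Let G be a finite game with players 1,…,n, nonempty finite strategy sets S_i, and payoff functions c_i : S → ℝ. If P₁ and P₂ are both exact potentials for G, then P₁ − P₂ is a constant function on S, i.e., there exists c₀ ∈ ℝ with P₁(s) − P₂(s) = c₀ for all s ∈ S. -/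
/-- `P` is an exact potential for the finite game with strategy sets `S i` and
payoffs `c i`: for every player `i`, every profile of the others (encoded by a full
profile `s`, whose `i`-th coordinate is irrelevant) and all `x y : S i`,
`c i (x, s₋ᵢ) - c i (y, s₋ᵢ) = P (x, s₋ᵢ) - P (y, s₋ᵢ)`. -/
def IsExactPotential {n : ℕ} {S : Fin n → Type*}
    (c : ∀ _ : Fin n, (∀ j, S j) → ℝ) (P : (∀ j, S j) → ℝ) : Prop :=
  ∀ (i : Fin n) (s : ∀ j, S j) (x y : S i),
    c i (Function.update s i x) - c i (Function.update s i y) =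
      P (Function.update s i x) - P (Function.update s i y)

/-- `s` is a pure Nash equilibrium: no player can strictly improve by a
unilateral deviation. -/
def IsPureNash {n : ℕ} {S : Fin n → Type*}
    (c : ∀ _ : Fin n, (∀ j, S j) → ℝ) (s : ∀ j, S j) : Prop :=
  ∀ (i : Fin n) (x : S i), c i (Function.update s i x) ≤ c i s


/-- Two exact potentials of a finite game differ by a constant. -/
theorem exact_potential_unique_up_to_const {n : ℕ} {S : Fin n → Type*}
    [∀ i, Fintype (S i)] [∀ i, Nonempty (S i)]
    (c : ∀ _ : Fin n, (∀ j, S j) → ℝ) (P₁ P₂ : (∀ j, S j) → ℝ)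
    (h₁ : IsExactPotential c P₁) (h₂ : IsExactPotential c P₂) :
    ∃ c₀ : ℝ, ∀ s : ∀ j, S j, P₁ s - P₂ s = c₀ := by
  classical
  let t : ∀ j, S j := fun j => Classical.arbitrary (S j)
  refine ⟨P₁ t - P₂ t, fun s => ?_⟩
  have key : ∀ A : Finset (Fin n),
      P₁ (A.piecewise s t) - P₂ (A.piecewise s t) = P₁ t - P₂ t := by
    intro A
    induction A using Finset.induction_on with
    | empty => simp
    | insert i A _ ih =>
      have e₁ := h₁ i (A.piecewise s t) (s i) (A.piecewise s t i)
      have e₂ := h₂ i (A.piecewise s t) (s i) (A.piecewise s t i)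
      rw [Function.update_eq_self] at e₁ e₂
      rw [Finset.piecewise_insert]
      convert ih using 1
      linarith
  simpa using key Finset.univ
end

section
/- Every finite game with players 1,…,n, nonempty finite strategy sets S_i, and payoff functions c_i : S → ℝ that admits an exact potential possesses at least one pure Nash equilibrium (any maximizer of the potential is one). -/
/-- Every finite game admitting an exact potential possesses a pure Nash equilibrium;
moreover any maximizer of the potential is one. -/
theorem exists_pureNash_of_potential {n : ℕ} {S : Fin n → Type*}
    [∀ i, Fintype (S i)] [∀ i, Nonempty (S i)]
    (c : ∀ _ : Fin n, (∀ j, S j) → ℝ)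
    (hpot : ∃ P : (∀ j, S j) → ℝ, IsExactPotential c P) :
    (∃ s : ∀ j, S j, IsPureNash c s) ∧
    ∀ P : (∀ j, S j) → ℝ, IsExactPotential c P →
      ∀ s : ∀ j, S j, (∀ s' : ∀ j, S j, P s' ≤ P s) → IsPureNash c s := by
  have key : ∀ P : (∀ j, S j) → ℝ, IsExactPotential c P →
      ∀ s : ∀ j, S j, (∀ s' : ∀ j, S j, P s' ≤ P s) → IsPureNash c s := by
    intro P hP s hs i x
    have h := hP i s x (s i)
    rw [Function.update_eq_self] at h
    have h2 := hs (Function.update s i x)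
    linarith
  refine ⟨?_, key⟩
  obtain ⟨P, hP⟩ := hpot
  obtain ⟨s, hs⟩ := Finite.exists_max P
  exact ⟨s, key P hP s hs⟩
end

section
/- Let G be a finite game with players 1,…,n (n ≥ 1), nonempty finite strategy sets S_i, and payoff functions c_i : S → ℝ. Then G admits an exact potential if and only if there exist functions d_i : S_{-i} → ℝ for i = 1,…,n such that for every profile s ∈ S and every player i, c_i(s) − d_i(s_{-i}) = c_1(s) − d_1(s_{-1}). Moreover, when such functions exist, P(s) := c_1(s) − d_1(s_{-1}) is an exact potential for G. -/
/-- A finite game admits an exact potential iff there are functions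
`d i : S₋ᵢ → ℝ` such that `c i s - d i s₋ᵢ` does not depend on the player `i`
(it always equals `c 1 s - d 1 s₋₁`, player `1` being the player of index `0`);
moreover, in that case `P s := c 1 s - d 1 s₋₁` is an exact potential. -/
theorem potential_iff_exists_d {n : ℕ} (hn : 0 < n) {S : Fin n → Type*}
    [∀ i, Fintype (S i)] [∀ i, Nonempty (S i)]
    (c : ∀ _ : Fin n, (∀ j, S j) → ℝ) :
    ((∃ P : (∀ j, S j) → ℝ, IsExactPotential c P) ↔
      ∃ d : ∀ i : Fin n, (∀ j : {j : Fin n // j ≠ i}, S j.1) → ℝ,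
        ∀ (s : ∀ j, S j) (i : Fin n),
          c i s - d i (fun j => s j.1) =
            c ⟨0, hn⟩ s - d ⟨0, hn⟩ (fun j => s j.1)) ∧
    ∀ d : ∀ i : Fin n, (∀ j : {j : Fin n // j ≠ i}, S j.1) → ℝ,
      (∀ (s : ∀ j, S j) (i : Fin n),
          c i s - d i (fun j => s j.1) =
            c ⟨0, hn⟩ s - d ⟨0, hn⟩ (fun j => s j.1)) →
      IsExactPotential c (fun s => c ⟨0, hn⟩ s - d ⟨0, hn⟩ (fun j => s j.1)) := by
  have key : ∀ d : ∀ i : Fin n, (∀ j : {j : Fin n // j ≠ i}, S j.1) → ℝ,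
      (∀ (s : ∀ j, S j) (i : Fin n),
          c i s - d i (fun j => s j.1) =
            c ⟨0, hn⟩ s - d ⟨0, hn⟩ (fun j => s j.1)) →
      IsExactPotential c (fun s => c ⟨0, hn⟩ s - d ⟨0, hn⟩ (fun j => s j.1)) := by
    intro d hd i s x y
    have hx := hd (Function.update s i x) i
    have hy := hd (Function.update s i y) i
    have e : (fun j : {j : Fin n // j ≠ i} => Function.update s i x j.1) =
        (fun j : {j : Fin n // j ≠ i} => Function.update s i y j.1) := by
      funext j
      rw [Function.update_of_ne j.2, Function.update_of_ne j.2]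
    rw [e] at hx
    show _ = (c ⟨0, hn⟩ (Function.update s i x) - d ⟨0, hn⟩ _) -
      (c ⟨0, hn⟩ (Function.update s i y) - d ⟨0, hn⟩ _)
    rw [← hx, ← hy]
    ring
  refine ⟨⟨?_, fun ⟨d, hd⟩ => ⟨_, key d hd⟩⟩, key⟩
  rintro ⟨P, hP⟩
  let a : ∀ i, S i := fun i => Classical.arbitrary (S i)
  let ext : ∀ i : Fin n, (∀ j : {j : Fin n // j ≠ i}, S j.1) → ∀ j, S j :=
    fun i t j => if h : j = i then a j else t ⟨j, h⟩
  have main : ∀ (s : ∀ j, S j) (i : Fin n),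
      c i s - (c i (ext i (fun j => s j.1)) - P (ext i (fun j => s j.1))) = P s := by
    intro s i
    have e : ext i (fun j => s j.1) = Function.update s i (a i) := by
      funext j
      by_cases h : j = i
      · subst h
        simp [ext]
      · simp [ext, h]
    have h := hP i s (s i) (a i)
    rw [Function.update_eq_self] at h
    rw [e]
    linarith
  exact ⟨fun i t => c i (ext i t) - P (ext i t),
    fun s i => (main s i).trans (main s ⟨0, hn⟩).symm⟩
end

section
/- Let G = (N, T, A, c, Pr) be a finite Bayesian game with all type marginals positive, and let a* ∈ A be an action profile. If a* is a Selten Bayesian–Nash equilibrium for every type profile t̄ ∈ T, i.e., for every t̄ ∈ T, every player i, and every a_i ∈ A_i one has c_i^{S,t̄}(a*) ≥ c_i^{S,t̄}(a_i, a*_{-i}), then a* is a Harsanyi Bayesian–Nash equilibrium, i.e., for every player i and every a_i ∈ A_i, c_i^H(a*) ≥ c_i^H(a_i, a*_{-i}). -/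
variable {n : ℕ} {T : Fin n → Type*} {A : Fin n → Type*}

/-- The marginal probability `Pr(tᵢ) = Σ_{t₋ᵢ} Pr(tᵢ, t₋ᵢ)` of type `tᵢ` of player `i`
under the common prior. -/
noncomputable def typeMarginal [∀ i, Fintype (T i)] [∀ i, DecidableEq (T i)]
    (prior : (∀ i, T i) → ℝ) (i : Fin n) (ti : T i) : ℝ :=
  ∑ t : ∀ j, T j, if t i = ti then prior t else 0

/-- The Harsanyi conversion payoff: `cᵢᴴ(a) = Σ_{t∈T} Pr(t) cᵢ(a,t)`. -/
noncomputable def harsanyiPayoff [∀ i, Fintype (T i)]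
    (prior : (∀ i, T i) → ℝ) (c : ∀ _ : Fin n, (∀ i, A i) → (∀ i, T i) → ℝ)
    (i : Fin n) (a : ∀ j, A j) : ℝ :=
  ∑ t : ∀ j, T j, prior t * c i a t

/-- The Selten conversion payoff for the fixed type profile `t̄`:
`cᵢ^{S,t̄}(a) = Σ_{t₋ᵢ} pᵢ(t₋ᵢ | t̄ᵢ) cᵢ(a, t̄ᵢ, t₋ᵢ)`, where
`pᵢ(t₋ᵢ | t̄ᵢ) = Pr(t̄ᵢ, t₋ᵢ)/Pr(t̄ᵢ)` is the belief of player `i`. -/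
noncomputable def seltenPayoff [∀ i, Fintype (T i)] [∀ i, DecidableEq (T i)]
    (prior : (∀ i, T i) → ℝ) (c : ∀ _ : Fin n, (∀ i, A i) → (∀ i, T i) → ℝ)
    (i : Fin n) (tbar : ∀ j, T j) (a : ∀ j, A j) : ℝ :=
  ∑ t : ∀ j, T j,
    (if t i = tbar i then prior t / typeMarginal prior i (tbar i) else 0) * c i a t

/-- The Action-Type conversion payoff:
`cᵢᴬᵀ(a, tᵢ) = Σ_{t₋ᵢ} pᵢ(t₋ᵢ | tᵢ) cᵢ(a, tᵢ, t₋ᵢ)`. -/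
noncomputable def atPayoff [∀ i, Fintype (T i)] [∀ i, DecidableEq (T i)]
    (prior : (∀ i, T i) → ℝ) (c : ∀ _ : Fin n, (∀ i, A i) → (∀ i, T i) → ℝ)
    (i : Fin n) (a : ∀ j, A j) (ti : T i) : ℝ :=
  ∑ t : ∀ j, T j,
    (if t i = ti then prior t / typeMarginal prior i ti else 0) * c i a t


/-- If `a*` is a Selten Bayesian–Nash equilibrium for every type profile `t̄`,
then `a*` is a Harsanyi Bayesian–Nash equilibrium. -/
theorem harsanyi_BNE_of_selten_BNE_forall
    [∀ i, Fintype (T i)] [∀ i, DecidableEq (T i)] [∀ i, Nonempty (T i)]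
    [∀ i, Fintype (A i)] [∀ i, Nonempty (A i)]
    (c : ∀ _ : Fin n, (∀ i, A i) → (∀ i, T i) → ℝ)
    (prior : (∀ i, T i) → ℝ)
    (hpr0 : ∀ t : ∀ j, T j, 0 ≤ prior t)
    (hpr1 : ∑ t : ∀ j, T j, prior t = 1)
    (hmarg : ∀ (i : Fin n) (ti : T i), 0 < typeMarginal prior i ti)
    (astar : ∀ j, A j)
    (hS : ∀ (tbar : ∀ j, T j) (i : Fin n) (ai : A i),
      seltenPayoff prior c i tbar (Function.update astar i ai) ≤
        seltenPayoff prior c i tbar astar) :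
    ∀ (i : Fin n) (ai : A i),
      harsanyiPayoff prior c i (Function.update astar i ai) ≤
        harsanyiPayoff prior c i astar := by
  intro i ai
  have t0 : ∀ j, T j := fun j => Classical.arbitrary (T j)
  have key : ∀ a : ∀ j, A j, harsanyiPayoff prior c i a =
      ∑ ti : T i, typeMarginal prior i ti *
        seltenPayoff prior c i (Function.update t0 i ti) a := by
    intro a
    unfold harsanyiPayoff seltenPayoff
    simp only [Function.update_self, Finset.mul_sum]
    rw [Finset.sum_comm]
    refine Finset.sum_congr rfl fun t _ => ?_
    rw [Finset.sum_eq_single (t i)]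
    · have h := (hmarg i (t i)).ne'
      rw [if_pos rfl]
      field_simp
    · intro b _ hb
      rw [if_neg (Ne.symm hb)]
      ring
    · intro h
      exact absurd (Finset.mem_univ _) h
  rw [key, key]
  exact Finset.sum_le_sum fun ti _ =>
    mul_le_mul_of_nonneg_left (hS _ i ai) (hmarg i ti).le
end

section
/- Let G = (N, T, A, c, Pr) be a finite Bayesian game with all type marginals positive and let c_i^{AT} : A × T_i → ℝ denote its Action-Type conversion payoffs. Then G is an Action-Type potential game if and only if there exist functions d_i : A_{-i} × T_{-i} → ℝ for i = 1,…,n such that for every (a, t) ∈ A × T and every player i, c_i^{AT}(a, t_i) − d_i(a_{-i}, t_{-i}) = c_1^{AT}(a, t_1) − d_1(a_{-1}, t_{-1}). Moreover, when such functions exist, Q^{AT}(a, t) := c_1^{AT}(a, t_1) − d_1(a_{-1}, t_{-1}) is an Action-Type potential function. -/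
variable {n : ℕ} {T : Fin n → Type*} {A : Fin n → Type*}

/-- `Q` is an Action-Type potential function: for every player `i`, all
`aᵢ, aᵢ' ∈ Aᵢ`, all `tᵢ, tᵢ' ∈ Tᵢ`, every `a₋ᵢ` and every `t₋ᵢ`,
`cᵢᴬᵀ(aᵢ', tᵢ', a₋ᵢ) − cᵢᴬᵀ(aᵢ, tᵢ, a₋ᵢ)
  = Q(aᵢ', a₋ᵢ, tᵢ', t₋ᵢ) − Q(aᵢ, a₋ᵢ, tᵢ, t₋ᵢ)`. -/
def IsATPotential [∀ i, Fintype (T i)] [∀ i, DecidableEq (T i)]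
    (prior : (∀ i, T i) → ℝ) (c : ∀ _ : Fin n, (∀ i, A i) → (∀ i, T i) → ℝ)
    (Q : (∀ i, A i) → (∀ i, T i) → ℝ) : Prop :=
  ∀ (i : Fin n) (a : ∀ j, A j) (t : ∀ j, T j) (ai ai' : A i) (ti ti' : T i),
    atPayoff prior c i (Function.update a i ai') ti' -
        atPayoff prior c i (Function.update a i ai) ti =
      Q (Function.update a i ai') (Function.update t i ti') -
        Q (Function.update a i ai) (Function.update t i ti)

/-- A finite Bayesian game (with positive type marginals) is an Action-Type
potential game iff there exist `dᵢ : A₋ᵢ × T₋ᵢ → ℝ` with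
`cᵢᴬᵀ(a, tᵢ) − dᵢ(a₋ᵢ, t₋ᵢ) = c₁ᴬᵀ(a, t₁) − d₁(a₋₁, t₋₁)` for all `(a,t)` and `i`;
moreover in that case `Qᴬᵀ(a,t) := c₁ᴬᵀ(a, t₁) − d₁(a₋₁, t₋₁)` is an
Action-Type potential function. -/
theorem atPotential_iff_exists_d (hn : 0 < n)
    [∀ i, Fintype (T i)] [∀ i, DecidableEq (T i)] [∀ i, Nonempty (T i)]
    [∀ i, Fintype (A i)] [∀ i, Nonempty (A i)]
    (c : ∀ _ : Fin n, (∀ i, A i) → (∀ i, T i) → ℝ)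
    (prior : (∀ i, T i) → ℝ)
    (hpr0 : ∀ t : ∀ j, T j, 0 ≤ prior t)
    (hpr1 : ∑ t : ∀ j, T j, prior t = 1)
    (hmarg : ∀ (i : Fin n) (ti : T i), 0 < typeMarginal prior i ti) :
    ((∃ Q : (∀ i, A i) → (∀ i, T i) → ℝ, IsATPotential prior c Q) ↔
      ∃ d : ∀ i : Fin n,
          (∀ j : {j : Fin n // j ≠ i}, A j.1) → (∀ j : {j : Fin n // j ≠ i}, T j.1) → ℝ,
        ∀ (a : ∀ j, A j) (t : ∀ j, T j) (i : Fin n),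
          atPayoff prior c i a (t i) - d i (fun j => a j.1) (fun j => t j.1) =
            atPayoff prior c ⟨0, hn⟩ a (t ⟨0, hn⟩) -
              d ⟨0, hn⟩ (fun j => a j.1) (fun j => t j.1)) ∧
    ∀ d : ∀ i : Fin n,
        (∀ j : {j : Fin n // j ≠ i}, A j.1) → (∀ j : {j : Fin n // j ≠ i}, T j.1) → ℝ,
      (∀ (a : ∀ j, A j) (t : ∀ j, T j) (i : Fin n),
          atPayoff prior c i a (t i) - d i (fun j => a j.1) (fun j => t j.1) =
            atPayoff prior c ⟨0, hn⟩ a (t ⟨0, hn⟩) -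
              d ⟨0, hn⟩ (fun j => a j.1) (fun j => t j.1)) →
      IsATPotential prior c (fun a t =>
        atPayoff prior c ⟨0, hn⟩ a (t ⟨0, hn⟩) -
          d ⟨0, hn⟩ (fun j => a j.1) (fun j => t j.1)) := by
  have key : ∀ d : ∀ i : Fin n,
        (∀ j : {j : Fin n // j ≠ i}, A j.1) → (∀ j : {j : Fin n // j ≠ i}, T j.1) → ℝ,
      (∀ (a : ∀ j, A j) (t : ∀ j, T j) (i : Fin n),
          atPayoff prior c i a (t i) - d i (fun j => a j.1) (fun j => t j.1) =
            atPayoff prior c ⟨0, hn⟩ a (t ⟨0, hn⟩) -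
              d ⟨0, hn⟩ (fun j => a j.1) (fun j => t j.1)) →
      IsATPotential prior c (fun a t =>
        atPayoff prior c ⟨0, hn⟩ a (t ⟨0, hn⟩) -
          d ⟨0, hn⟩ (fun j => a j.1) (fun j => t j.1)) := by
    intro d hd i a t ai ai' ti ti'
    have hA : ∀ x : A i, (fun j : {j : Fin n // j ≠ i} => Function.update a i x j.1) =
        fun j : {j : Fin n // j ≠ i} => a j.1 := by
      intro x
      funext j
      exact Function.update_of_ne j.2 _ _
    have hT : ∀ x : T i, (fun j : {j : Fin n // j ≠ i} => Function.update t i x j.1) =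
        fun j : {j : Fin n // j ≠ i} => t j.1 := by
      intro x
      funext j
      exact Function.update_of_ne j.2 _ _
    have h1 := hd (Function.update a i ai') (Function.update t i ti') i
    have h2 := hd (Function.update a i ai) (Function.update t i ti) i
    rw [hA, hT, Function.update_self] at h1 h2
    beta_reduce
    rw [← h1, ← h2]
    ring
  refine ⟨⟨?_, fun ⟨d, hd⟩ => ⟨_, key d hd⟩⟩, key⟩
  rintro ⟨Q, hQ⟩
  let a0 : ∀ i, A i := fun i => Classical.arbitrary _
  let t0 : ∀ i, T i := fun i => Classical.arbitrary _
  let eA : ∀ i : Fin n, (∀ j : {j : Fin n // j ≠ i}, A j.1) → ∀ j, A j :=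
    fun i a j => if h : j ≠ i then a ⟨j, h⟩ else a0 j
  let eT : ∀ i : Fin n, (∀ j : {j : Fin n // j ≠ i}, T j.1) → ∀ j, T j :=
    fun i t j => if h : j ≠ i then t ⟨j, h⟩ else t0 j
  let d : ∀ i : Fin n,
      (∀ j : {j : Fin n // j ≠ i}, A j.1) → (∀ j : {j : Fin n // j ≠ i}, T j.1) → ℝ :=
    fun i a t => atPayoff prior c i (eA i a) (t0 i) - Q (eA i a) (eT i t)
  have main : ∀ (a : ∀ j, A j) (t : ∀ j, T j) (i : Fin n),
      atPayoff prior c i a (t i) - d i (fun j => a j.1) (fun j => t j.1) = Q a t := by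
    intro a t i
    have hA : eA i (fun j => a j.1) = Function.update a i (a0 i) := by
      funext j
      by_cases h : j = i
      · subst h
        simp [eA]
      · simp [eA, h]
    have hT : eT i (fun j => t j.1) = Function.update t i (t0 i) := by
      funext j
      by_cases h : j = i
      · subst h
        simp [eT]
      · simp [eT, h]
    have h := hQ i a t (a0 i) (a i) (t0 i) (t i)
    rw [Function.update_eq_self, Function.update_eq_self] at h
    simp only [d, hA, hT]
    linarith
  exact ⟨d, fun a t i => by rw [main, main]⟩
end

section
/- Let G be a finite game with players 1,…,n, nonempty finite strategy sets S_i, payoff functions c_i : S → ℝ, admitting an exact potential P. Then there is no infinite sequence of profiles a(0), a(1), a(2), … in S such that for every k there exists a player i with a_{-i}(k+1) = a_{-i}(k) and c_i(a(k+1)) > c_i(a(k)); consequently, any asynchronous myopic best-response adjustment process in which each update strictly increases the updating player's payoff terminates after finitely many steps. -/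
/-- In a finite game with an exact potential there is no infinite sequence of
profiles in which each step is a unilateral deviation strictly improving the
deviating player's payoff; hence any asynchronous myopic best-response process
with strictly improving updates terminates in finitely many steps. -/
theorem no_infinite_improvement_path {n : ℕ} {S : Fin n → Type*}
    [∀ i, Fintype (S i)] [∀ i, Nonempty (S i)]
    (c : ∀ _ : Fin n, (∀ j, S j) → ℝ) (P : (∀ j, S j) → ℝ)
    (hP : IsExactPotential c P) :
    ¬ ∃ a : ℕ → ∀ j, S j, ∀ k : ℕ, ∃ i : Fin n,
        (∀ j : Fin n, j ≠ i → a (k + 1) j = a k j) ∧ c i (a k) < c i (a (k + 1)) := by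
  rintro ⟨a, ha⟩
  have hmono : StrictMono (fun k => P (a k)) := by
    apply strictMono_nat_of_lt_succ
    intro k
    obtain ⟨i, hi, hlt⟩ := ha k
    have hu : Function.update (a k) i (a (k + 1) i) = a (k + 1) := by
      funext j
      by_cases hj : j = i
      · subst hj
        simp
      · rw [Function.update_of_ne hj, hi j hj]
    have h := hP i (a k) (a (k + 1) i) (a k i)
    rw [hu, Function.update_eq_self] at h
    show P (a k) < P (a (k + 1))
    linarith
  have hinj : Function.Injective a := fun x y hxy =>
    hmono.injective (congrArg P hxy)
  exact not_injective_infinite_finite a hinj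
end

section
/- Let G be a finite game with players 1,…,n, nonempty finite strategy sets S_i, payoff functions u_i : S → ℝ, and exact potential Q. Fix a temperature T > 0 and selection probabilities q_1,…,q_n > 0 with Σ_i q_i = 1. Define the asynchronous logit-response transition kernel on S by P_T(a, a') := Σ_{i : a'_{-i} = a_{-i}} q_i · exp(u_i(a'_i, a_{-i})/T) / Σ_{x ∈ S_i} exp(u_i(x, a_{-i})/T) (so P_T(a,a') = 0 when a and a' differ in more than one coordinate), and define the Gibbs distribution μ_T(a) := exp(Q(a)/T) / Σ_{a' ∈ S} exp(Q(a')/T). Then μ_T satisfies the detailed balance condition μ_T(a) P_T(a, a') = μ_T(a') P_T(a', a) for all a, a' ∈ S, and hence μ_T is an invariant (stationary) distribution of the kernel: Σ_{a ∈ S} μ_T(a) P_T(a, a') = μ_T(a') for all a' ∈ S. -/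
/-- The asynchronous logit-response transition kernel at temperature `T` with player
selection probabilities `q`: `P_T(a,a') = Σ_{i : a'₋ᵢ = a₋ᵢ} qᵢ · exp(uᵢ(a'ᵢ,a₋ᵢ)/T) /
Σ_{x ∈ Sᵢ} exp(uᵢ(x,a₋ᵢ)/T)` (zero when `a` and `a'` differ in more than one coordinate). -/
noncomputable def logitKernel {n : ℕ} {S : Fin n → Type*}
    [∀ i, Fintype (S i)] [∀ i, DecidableEq (S i)]
    (u : ∀ _ : Fin n, (∀ j, S j) → ℝ) (T : ℝ) (q : Fin n → ℝ)
    (a a' : ∀ j, S j) : ℝ :=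
  ∑ i : Fin n,
    if ∀ j : Fin n, j ≠ i → a' j = a j then
      q i * Real.exp (u i a' / T) / ∑ x : S i, Real.exp (u i (Function.update a i x) / T)
    else 0

/-- The Gibbs distribution associated with the potential `Q` at temperature `T`. -/
noncomputable def gibbs {n : ℕ} {S : Fin n → Type*} [∀ i, Fintype (S i)]
    (Q : (∀ j, S j) → ℝ) (T : ℝ) (a : ∀ j, S j) : ℝ :=
  Real.exp (Q a / T) / ∑ a' : ∀ j, S j, Real.exp (Q a' / T)

theorem logitKernel_row_sum {n : ℕ} {S : Fin n → Type*}
    [∀ i, Fintype (S i)] [∀ i, Nonempty (S i)] [∀ i, DecidableEq (S i)]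
    (u : ∀ _ : Fin n, (∀ j, S j) → ℝ) (T : ℝ)
    (q : Fin n → ℝ) (hq1 : ∑ i : Fin n, q i = 1) (a : ∀ j, S j) :
    ∑ a' : ∀ j, S j, logitKernel u T q a a' = 1 := by
  unfold logitKernel
  rw [Finset.sum_comm, ← hq1]
  refine Finset.sum_congr rfl fun i _ => ?_
  rw [← Finset.sum_filter]
  have himg : (Finset.univ.filter fun a' : ∀ j, S j => ∀ j : Fin n, j ≠ i → a' j = a j) =
      Finset.univ.image (Function.update a i) := by
    ext b
    simp only [Finset.mem_filter, Finset.mem_univ, true_and, Finset.mem_image]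
    constructor
    · intro h
      refine ⟨b i, ?_⟩
      rw [Function.update_eq_iff]
      exact ⟨rfl, fun j hj => (h j hj).symm⟩
    · rintro ⟨x, rfl⟩ j hj
      exact Function.update_of_ne hj _ _
  rw [himg, Finset.sum_image (fun x _ y _ h => Function.update_injective a i h),
    ← Finset.sum_div, ← Finset.mul_sum]
  have hpos : 0 < ∑ x : S i, Real.exp (u i (Function.update a i x) / T) :=
    Finset.sum_pos (fun _ _ => Real.exp_pos _) Finset.univ_nonempty
  exact mul_div_cancel_right₀ _ hpos.ne'

theorem gibbs_logit_balance {n : ℕ} {S : Fin n → Type*}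
    [∀ i, Fintype (S i)] [∀ i, DecidableEq (S i)]
    (u : ∀ _ : Fin n, (∀ j, S j) → ℝ) (Q : (∀ j, S j) → ℝ)
    (hQ : IsExactPotential u Q) (T : ℝ) (q : Fin n → ℝ) (a a' : ∀ j, S j) :
    gibbs Q T a * logitKernel u T q a a' = gibbs Q T a' * logitKernel u T q a' a := by
  unfold logitKernel
  rw [Finset.mul_sum, Finset.mul_sum]
  refine Finset.sum_congr rfl fun i _ => ?_
  by_cases h : ∀ j : Fin n, j ≠ i → a' j = a j
  · have h' : ∀ j : Fin n, j ≠ i → a j = a' j := fun j hj => (h j hj).symm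
    rw [if_pos h, if_pos h']
    have e : ∀ x, Function.update a' i x = Function.update a i x := by
      intro x
      ext j
      by_cases hj : j = i
      · subst hj; simp
      · simp [Function.update_of_ne hj, h j hj]
    have ea : Function.update a i (a' i) = a' := by
      rw [← e, Function.update_eq_self]
    have hp := hQ i a (a i) (a' i)
    rw [ea, Function.update_eq_self] at hp
    simp only [e]
    have key : Real.exp (Q a / T) * Real.exp (u i a' / T) =
        Real.exp (Q a' / T) * Real.exp (u i a / T) := by
      rw [← Real.exp_add, ← Real.exp_add, ← add_div, ← add_div]
      congr 2
      linarith
    unfold gibbs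
    rw [div_mul_div_comm, div_mul_div_comm]
    congr 1
    linear_combination q i * key
  · have h' : ¬ ∀ j : Fin n, j ≠ i → a j = a' j := fun g => h fun j hj => (g j hj).symm
    rw [if_neg h, if_neg h', mul_zero, mul_zero]

/-- For a finite game with exact potential `Q`, the Gibbs distribution `μ_T` satisfies
detailed balance with respect to the asynchronous logit-response kernel, and hence is
an invariant (stationary) distribution of that kernel. -/
theorem gibbs_detailedBalance_and_invariant {n : ℕ} {S : Fin n → Type*}
    [∀ i, Fintype (S i)] [∀ i, Nonempty (S i)] [∀ i, DecidableEq (S i)]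
    (u : ∀ _ : Fin n, (∀ j, S j) → ℝ) (Q : (∀ j, S j) → ℝ)
    (hQ : IsExactPotential u Q)
    (T : ℝ) (hT : 0 < T)
    (q : Fin n → ℝ) (hq : ∀ i, 0 < q i) (hq1 : ∑ i : Fin n, q i = 1) :
    (∀ a a' : ∀ j, S j,
      gibbs Q T a * logitKernel u T q a a' = gibbs Q T a' * logitKernel u T q a' a) ∧
    (∀ a' : ∀ j, S j,
      ∑ a : ∀ j, S j, gibbs Q T a * logitKernel u T q a a' = gibbs Q T a') := by
  refine ⟨gibbs_logit_balance u Q hQ T q, fun a' => ?_⟩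
  rw [Finset.sum_congr rfl fun a _ => gibbs_logit_balance u Q hQ T q a a',
    ← Finset.mul_sum, logitKernel_row_sum u T q hq1, mul_one]
end
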